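/- For every β > 0 and all x₁, x₂ > 0, the ratio of the magnitudes of the partial derivatives of L_R satisfies |∂L_R/∂x₂| / |∂L_R/∂x₁| = x₁ / x₂; in particular, if x₁ > x₂ then the magnitude of the gradient with respect to x₂ strictly exceeds the magnitude of the gradient with respect to x₁. -/

import Mathlib

/-- Bradley–Terry loss `L_R(x₁, x₂) = -log( x₁^β / (x₁^β + x₂^β) )`. -/
noncomputable def LR (β x₁ x₂ : ℝ) : ℝ := -Real.log (x₁ ^ β / (x₁ ^ β + x₂ ^ β))

theorem LR_eq_log_sub (β : ℝ) {x₁ x₂ : ℝ} (hx₁ : 0 < x₁) (hx₂ : 0 < x₂) :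
    LR β x₁ x₂ = Real.log (x₁ ^ β + x₂ ^ β) - β * Real.log x₁ := by
  have h₁ := Real.rpow_pos_of_pos hx₁ β
  have h₂ := Real.rpow_pos_of_pos hx₂ β
  rw [LR, Real.log_div h₁.ne' (by positivity), Real.log_rpow hx₁, neg_sub]

theorem hasDerivAt_LR_left (β : ℝ) {x₁ x₂ : ℝ} (hx₁ : 0 < x₁) (hx₂ : 0 < x₂) :
    HasDerivAt (fun x => LR β x x₂) (-(β * x₂ ^ β / (x₁ * (x₁ ^ β + x₂ ^ β)))) x₁ := by
  have h₁ := Real.rpow_pos_of_pos hx₁ β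
  have h₂ := Real.rpow_pos_of_pos hx₂ β
  have hS : x₁ ^ β + x₂ ^ β ≠ 0 := by positivity
  have h := ((((Real.hasDerivAt_rpow_const (p := β) (Or.inl hx₁.ne')).add_const
    (x₂ ^ β)).log hS).sub ((Real.hasDerivAt_log hx₁.ne').const_mul β))
  refine (h.congr_of_eventuallyEq ?_).congr_deriv ?_
  · filter_upwards [eventually_gt_nhds hx₁] with x hx using LR_eq_log_sub β hx hx₂
  · rw [Real.rpow_sub_one hx₁.ne']
    field_simp
    ring

theorem hasDerivAt_LR_right (β : ℝ) {x₁ x₂ : ℝ} (hx₁ : 0 < x₁) (hx₂ : 0 < x₂) :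
    HasDerivAt (fun x => LR β x₁ x) (β * x₂ ^ β / (x₂ * (x₁ ^ β + x₂ ^ β))) x₂ := by
  have h₁ := Real.rpow_pos_of_pos hx₁ β
  have h₂ := Real.rpow_pos_of_pos hx₂ β
  have hS : x₁ ^ β + x₂ ^ β ≠ 0 := by positivity
  have h := (((Real.hasDerivAt_rpow_const (p := β) (Or.inl hx₂.ne')).const_add
    (x₁ ^ β)).log hS).sub_const (β * Real.log x₁)
  refine (h.congr_of_eventuallyEq ?_).congr_deriv ?_
  · filter_upwards [eventually_gt_nhds hx₂] with x hx using LR_eq_log_sub β hx₁ hx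
  · rw [Real.rpow_sub_one hx₂.ne']
    field_simp

theorem LR_grad_ratio (β : ℝ) (hβ : 0 < β) (x₁ x₂ : ℝ) (hx₁ : 0 < x₁) (hx₂ : 0 < x₂) :
    |deriv (fun x => LR β x₁ x) x₂| / |deriv (fun x => LR β x x₂) x₁| = x₁ / x₂ ∧
      (x₂ < x₁ → |deriv (fun x => LR β x x₂) x₁| < |deriv (fun x => LR β x₁ x) x₂|) := by
  have h₁ := Real.rpow_pos_of_pos hx₁ β
  have h₂ := Real.rpow_pos_of_pos hx₂ β
  rw [(hasDerivAt_LR_left β hx₁ hx₂).deriv, (hasDerivAt_LR_right β hx₁ hx₂).deriv, abs_neg,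
    abs_of_pos (by positivity), abs_of_pos (by positivity)]
  refine ⟨by field_simp, fun h => ?_⟩
  gcongr
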